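/- arXiv:2401.08208 — 2 statements merged into one kernel-verified Lean document; each statement's English description precedes it below -/
import Mathlib

section
/- Let 𝔸 be a finite multiset of nonnegative integers with distinct values 0 = a_0 < a_1 < ... < a_{k-1}, multiplicities r_i ≥ 1, gcd(a_1, ..., a_{k-1}) = 1, and r = min{r_1, ..., r_{k-1}} ≥ 2. Then |S(𝔸)| ≥ |(r-1)A| + min{a_{k-1}, r(k-2)+1} + Σ_{i=1}^{k-1}(i-1)·r_{i-1} + (k-1)(r_{k-1} - r), where (r-1)A is the (r-1)-fold sumset of A. -/
open Pointwise

/-- Set of all nonempty subset sums of a finite set of integers. -/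
def SetSub (A : Finset ℤ) : Finset ℤ :=
  (A.powerset.filter (fun B => B.Nonempty)).image fun B => B.sum id

/-- Set of all subset sums over subsets of cardinality at least `α`. -/
def SetSubAlpha (α : ℕ) (A : Finset ℤ) : Finset ℤ :=
  (A.powerset.filter (fun B => α ≤ B.card)).image fun B => B.sum id

/-- Set of all nonempty subsequence (sub-multiset) sums of a multiset of integers. -/
def SeqSub (A : Multiset ℤ) : Finset ℤ :=
  ((A.powerset.filter (fun B => B ≠ 0)).map Multiset.sum).toFinset

/-- Set of all sub-multiset sums with at least `α` terms. -/
def SeqSubAlpha (α : ℕ) (A : Multiset ℤ) : Finset ℤ :=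
  ((A.powerset.filter (fun B => α ≤ Multiset.card B)).map Multiset.sum).toFinset

/-- `h`-fold sumset of a finite set of integers. -/
def hfold : ℕ → Finset ℤ → Finset ℤ
  | 0, _ => {0}
  | n + 1, X => X + hfold n X

/-- Restricted 2-fold sumset: sums of two distinct elements. -/
def Res2 (A : Finset ℤ) : Finset ℤ :=
  ((A ×ˢ A).filter (fun p => p.1 ≠ p.2)).image fun p => p.1 + p.2

/-- The golden ratio. -/
noncomputable def theta : ℝ := (1 + Real.sqrt 5) / 2
open Finset in
/-- **Isoperimetric subgroup.** In a finite abelian group, the minimum of `#(X + S) - #X` over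
nonempty `X` with `X + S ≠ univ` is attained at a subgroup. -/
theorem exists_isoperimetric_subgroup {G : Type*} [AddCommGroup G] [Fintype G] [DecidableEq G]
    (S : Finset G) (hS : S ≠ univ) :
    ∃ (H : AddSubgroup G) (F : Finset G), (F : Set G) = H ∧ F + S ≠ univ ∧
      ∀ X : Finset G, X.Nonempty → X + S = univ ∨ #X + #(F + S) ≤ #(X + S) + #F := by
  classical
  let cand : Finset (Finset G) := {X | X.Nonempty ∧ X + S ≠ univ}
  let bd : Finset G → ℤ := fun X => (#(X + S) : ℤ) - #X
  have mem_cand : ∀ X, X ∈ cand ↔ X.Nonempty ∧ X + S ≠ univ := by simp [cand]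
  obtain ⟨F₀, hF₀, hmin₀⟩ := cand.exists_min_image bd
    ⟨{0}, by rw [mem_cand]; exact ⟨by simp, by rwa [singleton_zero, zero_add]⟩⟩
  obtain ⟨F₁, hF₁, hmin₁⟩ := (cand.filter fun X => bd X = bd F₀).exists_min_image Finset.card
    ⟨F₀, by simp [hF₀]⟩
  rw [mem_filter] at hF₁
  have bd_vadd : ∀ (g : G) X, bd (g +ᵥ X) = bd X := fun g X => by
    simp only [bd, vadd_add_assoc, card_vadd_finset]
  have cand_vadd : ∀ (g : G) X, X ∈ cand → g +ᵥ X ∈ cand := fun g X hX => by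
    rw [mem_cand] at hX ⊢
    refine ⟨hX.1.vadd_finset, fun h => hX.2 ?_⟩
    rw [vadd_add_assoc] at h
    rw [← card_eq_iff_eq_univ] at h ⊢
    rwa [card_vadd_finset] at h
  obtain ⟨f, hf⟩ := ((mem_cand _).1 hF₁.1).1
  obtain ⟨F, hFdef⟩ : ∃ F, F = -f +ᵥ F₁ := ⟨_, rfl⟩
  have hF0 : (0 : G) ∈ F := by
    rw [hFdef, mem_vadd_finset]; exact ⟨f, hf, by simp⟩
  have hFc : F ∈ cand := hFdef ▸ cand_vadd _ _ hF₁.1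
  have hFbd : bd F = bd F₀ := by rw [hFdef, bd_vadd, hF₁.2]
  have hFcard : #F = #F₁ := by rw [hFdef, card_vadd_finset]
  have hminbd : ∀ X ∈ cand, bd F ≤ bd X := fun X hX => hFbd ▸ hmin₀ X hX
  have hmincard : ∀ X ∈ cand, bd X ≤ bd F → #F ≤ #X := fun X hX hb => by
    rw [hFcard]
    exact hmin₁ X (mem_filter.2 ⟨hX, hFbd ▸ le_antisymm hb (hminbd X hX)⟩)
  have hF := (mem_cand F).1 hFc
  have hlt : #(F + S) < Fintype.card G := card_lt_iff_ne_univ _ |>.2 hF.2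
  -- the complement of an atom is, up to sign, again a minimiser
  have hdual : #F + #(F + S) ≤ Fintype.card G := by
    let D : Finset G := -(F + S)ᶜ
    have hD : #D + #(F + S) = Fintype.card G := by
      rw [card_neg, card_compl]; omega
    have hsub : D + S ⊆ (-F)ᶜ := by
      intro x hx
      obtain ⟨y, hy, s, hs, rfl⟩ := mem_add.1 hx
      simp only [D, mem_neg', mem_compl] at hy ⊢
      intro hmem
      exact hy (mem_add.2 ⟨_, hmem, s, hs, by abel⟩)
    have hcard := card_le_card hsub
    rw [card_compl, card_neg] at hcard
    have hFle : #F ≤ Fintype.card G := card_le_univ F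
    have hFpos : 0 < #F := hF.1.card_pos
    have hDc : D ∈ cand := by
      rw [mem_cand]
      refine ⟨card_pos.1 (by omega), fun h => ?_⟩
      rw [h, card_univ] at hcard
      omega
    have := hmincard D hDc (by simp only [bd]; omega)
    omega
  have hstab : ∀ g ∈ F, g +ᵥ F = F := by
    intro g hg
    have hgI : g ∈ (g +ᵥ F) ∩ F :=
      mem_inter.2 ⟨mem_vadd_finset.2 ⟨0, hF0, by simp⟩, hg⟩
    have hIsub : ((g +ᵥ F) ∩ F) + S ⊆ F + S := add_subset_add_right inter_subset_right
    have hIc : (g +ᵥ F) ∩ F ∈ cand := by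
      rw [mem_cand]
      exact ⟨⟨g, hgI⟩, fun h => hF.2 (univ_subset_iff.1 (h ▸ hIsub))⟩
    have h1 := card_union_add_card_inter (g +ᵥ F) F
    have h2 := card_union_add_card_inter ((g +ᵥ F) + S) (F + S)
    rw [← union_add] at h2
    have h3 : #(((g +ᵥ F) ∩ F) + S) ≤ #(((g +ᵥ F) + S) ∩ (F + S)) :=
      card_le_card inter_add_subset
    have h4 : #((g +ᵥ F) + S) = #(F + S) := by rw [vadd_add_assoc, card_vadd_finset]
    have h5 : #(g +ᵥ F) = #F := card_vadd_finset _ _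
    have h6 := hminbd _ hIc
    have hIpos : 0 < #((g +ᵥ F) ∩ F) := card_pos.2 ⟨g, hgI⟩
    have hUc : (g +ᵥ F) ∪ F ∈ cand := by
      rw [mem_cand]
      refine ⟨⟨g, mem_union_right _ hg⟩, fun h => ?_⟩
      rw [h, card_univ] at h2
      simp only [bd] at h6
      omega
    have h7 := hminbd _ hUc
    have h8 := hmincard _ hIc (by simp only [bd] at h6 h7 ⊢; omega)
    have e1 : (g +ᵥ F) ∩ F = F := eq_of_subset_of_card_le inter_subset_right h8
    exact (eq_of_subset_of_card_le (inter_eq_right.1 e1) h5.le).symm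
  refine ⟨{ carrier := F, add_mem' := ?_, zero_mem' := hF0, neg_mem' := ?_ }, F, rfl, hF.2, ?_⟩
  · intro x y hx hy
    have : x +ᵥ y ∈ x +ᵥ F := vadd_mem_vadd_finset hy
    rwa [hstab x hx] at this
  · intro x hx
    have : (0 : G) ∈ x +ᵥ F := by rwa [hstab x hx]
    obtain ⟨y, hy, hxy⟩ := mem_vadd_finset.1 this
    rw [vadd_eq_add] at hxy
    rwa [← eq_neg_of_add_eq_zero_right hxy]
  · intro X hX
    by_cases h : X + S = univ
    · exact Or.inl h
    · have := hminbd X ((mem_cand X).2 ⟨hX, h⟩)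
      simp only [bd] at this
      right; omega

section IterSum

open Finset

variable {G Q : Type*} [AddCommGroup G] [DecidableEq G] [AddCommGroup Q] [DecidableEq Q]

/-- The `n`-fold sumset in an arbitrary commutative group. -/
def iterSum (S : Finset G) : ℕ → Finset G
  | 0 => {0}
  | n + 1 => iterSum S n + S

theorem hfold_eq_iterSum (n : ℕ) (A : Finset ℤ) : hfold n A = iterSum A n := by
  induction n with
  | zero => rfl
  | succ n ih => rw [hfold, iterSum, ih, add_comm]

theorem mem_iterSum_succ {S : Finset G} {n : ℕ} {x : G} :
    x ∈ iterSum S (n + 1) ↔ ∃ y ∈ iterSum S n, ∃ s ∈ S, y + s = x := mem_add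

theorem add_mem_iterSum {S : Finset G} {n : ℕ} {x s : G} (hx : x ∈ iterSum S n) (hs : s ∈ S) :
    x + s ∈ iterSum S (n + 1) := add_mem_add hx hs

theorem iterSum_subset_succ {S : Finset G} (h0 : 0 ∈ S) (n : ℕ) :
    iterSum S n ⊆ iterSum S (n + 1) := fun x hx => by
  simpa using add_mem_iterSum hx h0

theorem nsmul_mem_iterSum {S : Finset G} {s : G} (hs : s ∈ S) (n : ℕ) :
    n • s ∈ iterSum S n := by
  induction n with
  | zero => simp [iterSum]
  | succ n ih => rw [succ_nsmul]; exact add_mem_iterSum ih hs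

theorem iterSum_nonempty {S : Finset G} (h0 : 0 ∈ S) (n : ℕ) : (iterSum S n).Nonempty :=
  ⟨_, nsmul_mem_iterSum h0 n⟩

theorem image_iterSum (f : G →+ Q) (S : Finset G) (n : ℕ) :
    (iterSum S n).image f = iterSum (S.image f) n := by
  induction n with
  | zero => simp [iterSum]
  | succ n ih => rw [iterSum, iterSum, image_add, ih]

theorem map_mem_iterSum_image (f : G →+ Q) {S : Finset G} {n : ℕ} {x : G} (hx : x ∈ iterSum S n) :
    f x ∈ iterSum (S.image f) n :=
  image_iterSum f S n ▸ mem_image_of_mem f hx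

theorem exists_mem_iterSum_of_mem_image (f : G →+ Q) {S : Finset G} {n : ℕ} {c : Q}
    (hc : c ∈ iterSum (S.image f) n) : ∃ x ∈ iterSum S n, f x = c := by
  rw [← image_iterSum] at hc; exact mem_image.1 hc

/-- An iterated sum other than `n • b` can be written with a last summand different from `b`. -/
theorem exists_summand_ne {B : Finset G} {b c : G} {n : ℕ} (hc : c ∈ iterSum B (n + 1))
    (hne : c ≠ (n + 1) • b) : ∃ x ∈ iterSum B n, ∃ b' ∈ B, b' ≠ b ∧ x + b' = c := by
  induction n generalizing c with
  | zero =>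
    obtain ⟨x, hx, b', hb', rfl⟩ := mem_iterSum_succ.1 hc
    refine ⟨x, hx, b', hb', ?_, rfl⟩
    rintro rfl
    simp only [iterSum, mem_singleton] at hx
    simp [hx] at hne
  | succ n ih =>
    obtain ⟨x, hx, b₁, hb₁, rfl⟩ := mem_iterSum_succ.1 hc
    by_cases h : b₁ = b
    · subst h
      obtain ⟨y, hy, b', hb', hne', rfl⟩ := ih hx (by
        rintro rfl; exact hne (succ_nsmul _ _).symm)
      exact ⟨y + b₁, add_mem_iterSum hy hb₁, b', hb', hne', by abel⟩
    · exact ⟨x, hx, b₁, hb₁, h, rfl⟩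

/-- Iterating a lower bound on the growth of sumsets. -/
theorem card_iterSum_add [Fintype G] {S : Finset G} {d : ℤ}
    (hd : ∀ X : Finset G, X.Nonempty → X + S = univ ∨ (#X : ℤ) + d ≤ #(X + S))
    (h0 : 0 ∈ S) (n : ℕ) :
    iterSum S (n + 1) = univ ∨ (#S : ℤ) + n * d ≤ #(iterSum S (n + 1)) := by
  induction n with
  | zero => right; simp [iterSum]
  | succ n ih =>
    rcases hd _ (iterSum_nonempty h0 (n + 1)) with h | h
    · exact Or.inl h
    · rcases ih with ih | ih
      · left
        exact univ_subset_iff.1 (ih ▸ iterSum_subset_succ h0 (n + 1))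
      · right
        change _ ≤ (#(iterSum S (n + 1) + S) : ℤ)
        push_cast
        linarith

theorem card_fiber_iterSum_succ (A : Finset ℤ) (f : ℤ →+ Q) (n : ℕ) {x b : Q}
    (hx : x ∈ iterSum (A.image f) n) (hb : b ∈ A.image f) :
    #{y ∈ iterSum A n | f y = x} + #{y ∈ A | f y = b} ≤
      #{y ∈ iterSum A (n + 1) | f y = x + b} + 1 := by
  obtain ⟨y, hy, rfl⟩ := exists_mem_iterSum_of_mem_image f hx
  obtain ⟨z, hz, rfl⟩ := mem_image.1 hb
  have h := cauchy_davenport_add_of_linearOrder_isCancelAdd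
    (s := {w ∈ iterSum A n | f w = f y}) (t := {w ∈ A | f w = f z})
    ⟨y, by simp [hy]⟩ ⟨z, by simp [hz]⟩
  have hsub : {w ∈ iterSum A n | f w = f y} + {w ∈ A | f w = f z} ⊆
      {w ∈ iterSum A (n + 1) | f w = f y + f z} := by
    intro w hw
    obtain ⟨u, hu, v, hv, rfl⟩ := mem_add.1 hw
    rw [mem_filter] at hu hv ⊢
    exact ⟨add_mem_iterSum hu.1 hv.1, by rw [map_add, hu.2, hv.2]⟩
  have := card_le_card hsub
  omega

/-- If all fibers of `A` have at least `t` elements, those of the `n`-fold sumset have at least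
`n * (t - 1) + 1`. -/
theorem le_card_fiber_iterSum (A : Finset ℤ) (f : ℤ →+ Q) {t : ℤ}
    (ht : ∀ b ∈ A.image f, t ≤ #{y ∈ A | f y = b}) (n : ℕ) {c : Q}
    (hc : c ∈ iterSum (A.image f) n) :
    n * (t - 1) + 1 ≤ (#{y ∈ iterSum A n | f y = c} : ℤ) := by
  induction n generalizing c with
  | zero =>
    simp only [iterSum, mem_singleton] at hc
    subst hc
    have : 0 < #{y ∈ iterSum A 0 | f y = 0} := card_pos.2 ⟨0, by simp [iterSum]⟩
    push_cast
    omega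
  | succ n ih =>
    obtain ⟨x, hx, b, hb, rfl⟩ := mem_iterSum_succ.1 hc
    have h1 := card_fiber_iterSum_succ A f n hx hb
    have h2 := ih hx
    have h3 := ht b hb
    push_cast
    zify at h1
    linarith

/-- Adding two fibers whose sizes exceed the size of the kernel fills a coset. -/
theorem mem_iterSum_of_card_fibers [Fintype G] (S : Finset G) (f : G →+ Q) {q n : ℕ}
    (hq : ∀ c, #{y : G | f y = c} = q) {x b b' : Q} (hx : x ∈ iterSum (S.image f) n)
    (hbb : q < #{s ∈ S | f s = b} + #{s ∈ S | f s = b'})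
    {g : G} (hg : f g = x + b + b') : g ∈ iterSum S (n + 2) := by
  obtain ⟨y, hy, rfl⟩ := exists_mem_iterSum_of_mem_image f hx
  have hq' := hq b
  let U : Finset G := {s ∈ S | f s = b}
  let V : Finset G := ({s ∈ S | f s = b'} : Finset G).image fun s => g - y - s
  have hV : #V = #{s ∈ S | f s = b'} :=
    card_image_of_injective _ fun s s' h => by simpa using h
  have hUV : U ∪ V ⊆ ({z : G | f z = b} : Finset G) := by
    intro z hz
    simp only [U, V, mem_union, mem_filter, mem_image, mem_univ, true_and] at hz ⊢
    rcases hz with hz | ⟨s, hs, rfl⟩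
    · exact hz.2
    · rw [map_sub, map_sub, hg, hs.2]; abel
  have hcard := card_le_card hUV
  have hui := card_union_add_card_inter U V
  have hpos : 0 < #(U ∩ V) := by
    have : #U = #{s ∈ S | f s = b} := rfl
    omega
  obtain ⟨s, hs⟩ := card_pos.1 hpos
  simp only [U, V, mem_inter, mem_filter, mem_image] at hs
  obtain ⟨⟨hsS, -⟩, s', ⟨hsS', -⟩, h⟩ := hs
  have : g = y + s' + s := by rw [← h]; abel
  rw [this]
  exact add_mem_iterSum (add_mem_iterSum hy hsS') hsS

/-- Multiplicity gain in a residue class: shifting by `l` and adding the least element. -/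
theorem card_fiber_succ_le (A : Finset ℤ) (φ : ℤ →+ G) {l : ℤ} (hl : 0 < l) (hφ : φ l = 0)
    (h0 : 0 ∈ A) (hlA : l ∈ A) {n : ℕ} {g : G} (hg : g ∈ iterSum (A.image φ) (n + 1)) :
    #{x ∈ iterSum A n | φ x = g} + 1 ≤ #{x ∈ iterSum A (n + 1) | φ x = g} := by
  rcases ({x ∈ iterSum A n | φ x = g} : Finset ℤ).eq_empty_or_nonempty with h | h
  · rw [h, card_empty, zero_add, Nat.one_le_iff_ne_zero, ← Nat.pos_iff_ne_zero, card_pos]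
    obtain ⟨x, hx, hxg⟩ := exists_mem_iterSum_of_mem_image φ hg
    exact ⟨x, mem_filter.2 ⟨hx, hxg⟩⟩
  · let m := ({x ∈ iterSum A n | φ x = g} : Finset ℤ).min' h
    have hm : m ∈ ({x ∈ iterSum A n | φ x = g} : Finset ℤ) := min'_mem _ _
    have hnot : m ∉ ({x ∈ iterSum A n | φ x = g} : Finset ℤ).image (· + l) := by
      intro hmem
      obtain ⟨x, hx, hxm⟩ := mem_image.1 hmem
      have := min'_le _ x hx
      change m ≤ x at this
      omega
    rw [← card_image_of_injective {x ∈ iterSum A n | φ x = g} (add_left_injective l),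
      ← card_insert_of_notMem hnot]
    refine card_le_card (insert_subset ?_ ?_)
    · rw [mem_filter] at hm ⊢
      exact ⟨iterSum_subset_succ h0 n hm.1, hm.2⟩
    · intro y hy
      obtain ⟨x, hx, rfl⟩ := mem_image.1 hy
      rw [mem_filter] at hx ⊢
      exact ⟨add_mem_iterSum hx.1 hlA, by rw [map_add, hφ, add_zero, hx.2]⟩

theorem card_filter_map_eq_sum [Fintype G] (φ : ℤ →+ G) (f : G →+ Q) (P : Finset ℤ) (c : Q) :
    #{x ∈ P | f (φ x) = c} = ∑ g : G with f g = c, #{x ∈ P | φ x = g} := by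
  rw [card_eq_sum_card_fiberwise (f := φ) (t := {g : G | f g = c})]
  · refine sum_congr rfl fun g hg => ?_
    rw [filter_filter]
    congr 1
    ext x
    simp only [mem_filter, mem_univ, true_and] at hg ⊢
    constructor
    · rintro ⟨hx, -, h⟩; exact ⟨hx, h⟩
    · rintro ⟨hx, rfl⟩; exact ⟨hx, hg, rfl⟩
  · intro x hx
    simpa using (mem_filter.1 (mem_coe.1 hx)).2

/-- The gain from the `n`-fold to the `(n + 1)`-fold sumset over a coset is at least the number of
residues of the latter in that coset. -/
theorem card_coset_add_le [Fintype G] (A : Finset ℤ) (φ : ℤ →+ G) (f : G →+ Q) {l : ℤ}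
    (hl : 0 < l) (hφ : φ l = 0) (h0 : 0 ∈ A) (hlA : l ∈ A) (n : ℕ) (c : Q) :
    #{x ∈ iterSum A n | f (φ x) = c} + #{g ∈ iterSum (A.image φ) (n + 1) | f g = c} ≤
      #{x ∈ iterSum A (n + 1) | f (φ x) = c} := by
  have hcard : #{g ∈ iterSum (A.image φ) (n + 1) | f g = c} =
      ∑ g : G with f g = c, if g ∈ iterSum (A.image φ) (n + 1) then 1 else 0 := by
    rw [sum_boole, filter_filter, Nat.cast_id]
    congr 1
    ext g
    simp [and_comm]
  rw [card_filter_map_eq_sum, card_filter_map_eq_sum, hcard, ← sum_add_distrib]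
  refine sum_le_sum fun g _ => ?_
  split_ifs with h
  · exact card_fiber_succ_le A φ hl hφ h0 hlA h
  · exact card_le_card (filter_subset_filter _ (iterSum_subset_succ h0 n))

end IterSum

open Finset in
theorem card_preimage_of_card_fiber {G Q : Type*} [AddCommGroup G] [Fintype G]
    [AddCommGroup Q] [DecidableEq Q] {f : G →+ Q} {q : ℕ} (hq : ∀ c, #{y : G | f y = c} = q)
    (X : Finset Q) : #{g : G | f g ∈ X} = #X * q := by
  rw [card_eq_sum_card_fiberwise (f := f) (t := X) (by intro x hx; simpa using hx),
    ← smul_eq_mul, ← sum_const]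
  refine sum_congr rfl fun c hc => ?_
  rw [← hq c, filter_filter]
  congr 1
  ext g
  simp only [mem_filter, mem_univ, true_and, and_iff_right_iff_imp]
  rintro rfl
  exact hc

open Finset in
theorem preimage_add_eq {G Q : Type*} [AddCommGroup G] [Fintype G] [DecidableEq G]
    [AddCommGroup Q] [DecidableEq Q] {f : G →+ Q} (S : Finset G) (X : Finset Q) :
    ({g : G | f g ∈ X} : Finset G) + S = ({g : G | f g ∈ X + S.image f} : Finset G) := by
  ext g
  simp only [mem_add, mem_filter, mem_univ, true_and, mem_image]
  constructor
  · rintro ⟨y, hy, s, hs, rfl⟩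
    exact ⟨f y, hy, f s, ⟨s, hs, rfl⟩, (map_add f y s).symm⟩
  · rintro ⟨c, hc, _, ⟨s, hs, rfl⟩, h⟩
    exact ⟨g - s, by rwa [map_sub, ← h, add_sub_cancel_right], s, hs, sub_add_cancel g s⟩

section Growth

open Finset

variable {G Q : Type*} [AddCommGroup G] [Fintype G] [DecidableEq G]
  [AddCommGroup Q] [Fintype Q] [DecidableEq Q]

/-- The growth of sumsets of integers, given that the residues satisfy isoperimetric inequalities
coming from a quotient. -/
theorem iterSum_growth_of_isoperimetric (A : Finset ℤ) (φ : ℤ →+ G) (f : G →+ Q) {l : ℤ}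
    (hl : 0 < l) (hφ : φ l = 0) (h0 : 0 ∈ A) (hlA : l ∈ A) {q : ℕ}
    (hq : ∀ c, #{y : G | f y = c} = q) {S : Finset G} (hS : S = A.image φ)
    {B : Finset Q} (hB : B = S.image f) (hM : 2 ≤ #B)
    (hG : ∀ X : Finset G, X.Nonempty → X + S = univ ∨ (#X : ℤ) + (#B - 1) * q ≤ #(X + S))
    (hQ : ∀ X : Finset Q, X.Nonempty → X + B = univ ∨ (#X : ℤ) + (#B - 1) ≤ #(X + B)) (n : ℕ) :
    (#(iterSum A (n + 1)) : ℤ) + min (Fintype.card G : ℤ) ((n + 2) * (#S - 1) + 1) ≤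
      #(iterSum A (n + 2)) := by
  have hS0 : 0 ∈ S := hS ▸ mem_image.2 ⟨0, h0, map_zero φ⟩
  have hB0 : 0 ∈ B := hB ▸ mem_image.2 ⟨0, hS0, map_zero f⟩
  have hAB : A.image (f.comp φ) = B := by rw [hB, hS, image_image]; rfl
  have hsimple : #(iterSum A (n + 1)) + #(iterSum S (n + 2)) ≤ #(iterSum A (n + 2)) := by
    have := card_coset_add_le A φ (0 : G →+ G) hl hφ h0 hlA (n + 1) 0
    simpa [hS] using this
  by_cases hfull : iterSum S (n + 2) = univ
  · rw [hfull, card_univ] at hsimple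
    have := min_le_left (Fintype.card G : ℤ) ((n + 2) * (#S - 1) + 1)
    omega
  refine le_trans (add_le_add_right (min_le_right _ _) _) ?_
  obtain ⟨t, ht⟩ : ∃ t : ℤ, t = #S - (#B - 1) * q := ⟨_, rfl⟩
  by_cases ht0 : t ≤ 0
  · rcases card_iterSum_add hG hS0 (n + 1) with h | h
    · exact absurd h hfull
    · push_cast at h
      have : 0 ≤ ((n : ℤ) + 1) * ((#B - 1) * q - #S) := mul_nonneg (by positivity) (by linarith)
      have hn : (0 : ℤ) ≤ n := by positivity
      zify at hsimple
      linarith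
  replace ht0 : 0 < t := not_le.1 ht0
  let s : Q → ℤ := fun b => #{x ∈ S | f x = b}
  have hsq : ∀ b, s b ≤ q := fun b => by
    rw [← hq b]
    exact Nat.cast_le.2 (card_le_card (filter_subset_filter _ (subset_univ _)))
  have hssum : ∑ b ∈ B, s b = #S := by
    have := card_eq_sum_card_fiberwise (f := f) (s := S) (t := B)
      (fun x hx => hB ▸ mem_image_of_mem f hx)
    rw [this]; push_cast; rfl
  have hst : ∀ b ∈ B, t ≤ s b := fun b hb => by
    have h1 := sum_erase_add B s hb
    have h2 := sum_le_card_nsmul (B.erase b) s q fun b _ => hsq b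
    rw [card_erase_of_mem hb, nsmul_eq_mul, Nat.cast_sub (by omega)] at h2
    push_cast at h2
    linarith
  have hspair : ∀ b ∈ B, ∀ b' ∈ B, b ≠ b' → q + t ≤ s b + s b' := fun b hb b' hb' hne => by
    have h1 := sum_erase_add B s hb
    have hb'e := mem_erase.2 ⟨hne.symm, hb'⟩
    have h1' := sum_erase_add (B.erase b) s hb'e
    have h2 := sum_le_card_nsmul ((B.erase b).erase b') s q fun b _ => hsq b
    rw [card_erase_of_mem hb'e, card_erase_of_mem hb, nsmul_eq_mul, Nat.sub_sub,
      Nat.cast_sub (by omega)] at h2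
    push_cast at h2
    linarith
  obtain ⟨b₀, hb₀, hmin⟩ := B.exists_min_image s ⟨0, hB0⟩
  obtain ⟨c₁, hc₁⟩ : ∃ c₁, c₁ = (n + 2) • b₀ := ⟨_, rfl⟩
  have hcoset : ∀ x ∈ iterSum B (n + 1), ∀ b ∈ B, b ≠ b₀ → ∀ g, f g = x + b →
      g ∈ iterSum S (n + 2) := by
    intro x hx b hb hne g hg
    obtain ⟨x', hx', b', hb', rfl⟩ := mem_iterSum_succ.1 hx
    refine mem_iterSum_of_card_fibers S f hq (hB ▸ hx') ?_ hg
    have h1 := hspair b hb b₀ hb₀ hne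
    have h2 := hmin b' hb'
    zify
    change (q : ℤ) < s b' + s b
    linarith
  have hcoset' : ∀ c ∈ iterSum B (n + 2), c ≠ c₁ → ∀ g, f g = c → g ∈ iterSum S (n + 2) := by
    intro c hc hne g hg
    obtain ⟨x, hx, b, hb, hbne, rfl⟩ := exists_summand_ne hc (hc₁ ▸ hne)
    exact hcoset x hx b hb hbne g hg
  obtain ⟨hN, c, hcB, hcnew⟩ : ((n : ℤ) + 2) * (#B - 1) + 1 ≤ #(iterSum B (n + 2)) ∧
      ∃ c ∈ iterSum B (n + 2), c ∉ iterSum B (n + 1) := by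
    by_cases huniv : iterSum B (n + 2) = univ
    · obtain ⟨g, hg⟩ : ∃ g, g ∉ iterSum S (n + 2) := by
        by_contra! h; exact hfull (eq_univ_of_forall h)
      have hgc : f g = c₁ := by
        by_contra h
        exact hg (hcoset' _ (huniv ▸ mem_univ _) h g rfl)
      have hno : ∀ b ∈ B, b ≠ b₀ → c₁ - b ∉ iterSum B (n + 1) := fun b hb hne hmem =>
        hg (hcoset _ hmem b hb hne g (by rw [hgc]; abel))
      obtain ⟨b, hb⟩ : (B.erase b₀).Nonempty := by
        rw [← card_pos, card_erase_of_mem hb₀]; omega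
      have hnu := hno b (mem_of_mem_erase hb) (ne_of_mem_erase hb)
      refine ⟨?_, c₁ - b, huniv ▸ mem_univ _, hnu⟩
      have h1 := (card_iterSum_add hQ hB0 n).resolve_left fun h => hnu (h ▸ mem_univ _)
      have hdisj : Disjoint ((B.erase b₀).image (c₁ - ·)) (iterSum B (n + 1)) := by
        rw [disjoint_left]
        intro z hz
        obtain ⟨b, hb, rfl⟩ := mem_image.1 hz
        exact hno b (mem_of_mem_erase hb) (ne_of_mem_erase hb)
      have h2 := card_le_univ ((B.erase b₀).image (c₁ - ·) ∪ iterSum B (n + 1))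
      rw [card_union_of_disjoint hdisj, card_image_of_injective _ (sub_right_injective),
        card_erase_of_mem hb₀] at h2
      rw [huniv, card_univ]
      zify [show 1 ≤ #B by omega] at h2
      linarith
    · constructor
      · have := (card_iterSum_add hQ hB0 (n + 1)).resolve_left huniv
        push_cast at this
        linarith
      · by_contra! h
        have h1 := card_le_card (show iterSum B (n + 2) ⊆ iterSum B (n + 1) from h)
        have h2 := (hQ _ (iterSum_nonempty hB0 (n + 1))).resolve_left huniv
        change _ ≤ (#(iterSum B (n + 2)) : ℤ) at h2
        omega
  let D : Q → ℤ := fun c =>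
    #{x ∈ iterSum A (n + 2) | f (φ x) = c} - #{x ∈ iterSum A (n + 1) | f (φ x) = c}
  have hDsum : ∑ c, D c = #(iterSum A (n + 2)) - #(iterSum A (n + 1)) := by
    have hcosets : ∀ P : Finset ℤ, (#P : ℤ) = ∑ c, (#{x ∈ P | f (φ x) = c} : ℤ) := fun P => by
      exact_mod_cast card_eq_sum_card_fiberwise (f := fun x => f (φ x)) (t := univ) (by simp)
    rw [hcosets (iterSum A (n + 2)), hcosets (iterSum A (n + 1)), ← sum_sub_distrib]
  have hDge : ∀ c, (#{g ∈ iterSum S (n + 2) | f g = c} : ℤ) ≤ D c := fun c => by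
    have := card_coset_add_le A φ f hl hφ h0 hlA (n + 1) c
    rw [← hS] at this
    change _ + #{g ∈ iterSum S (n + 2) | f g = c} ≤ #{x ∈ iterSum A (n + 2) | f (φ x) = c} at this
    simp only [D]
    omega
  have hDB : ∑ c ∈ iterSum B (n + 2), D c ≤ ∑ c, D c :=
    sum_le_univ_sum_of_nonneg fun c => le_trans (by positivity) (hDge c)
  have hDq : ∀ c ∈ iterSum B (n + 2), c ≠ c₁ → q ≤ D c := fun c hc hne => by
    refine le_trans ?_ (hDge c)
    rw [← hq c, Nat.cast_le]
    refine card_le_card fun g hg => ?_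
    rw [mem_filter] at hg ⊢
    exact ⟨hcoset' c hc hne g hg.2, hg.2⟩
  have hDc : D c = #{x ∈ iterSum A (n + 2) | f (φ x) = c} := by
    simp only [D, sub_eq_self, Nat.cast_eq_zero, card_eq_zero]
    refine filter_false_of_mem fun x hx hxc => hcnew ?_
    rw [← hxc, ← hAB]
    exact map_mem_iterSum_image (f.comp φ) hx
  have hsA : ∀ b, s b ≤ #{y ∈ A | f.comp φ y = b} := fun b => by
    have : ({x ∈ S | f x = b} : Finset G) ⊆ ({y ∈ A | f.comp φ y = b} : Finset ℤ).image φ := by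
      intro x hx
      rw [mem_filter, hS] at hx
      obtain ⟨⟨y, hy, rfl⟩, hb⟩ := And.imp_left mem_image.1 hx
      exact mem_image_of_mem _ (mem_filter.2 ⟨hy, hb⟩)
    exact Nat.cast_le.2 ((card_le_card this).trans card_image_le)
  have hfib : ∀ (m : ℕ), ∀ c ∈ iterSum B m,
      m * (t - 1) + 1 ≤ (#{y ∈ iterSum A m | f.comp φ y = c} : ℤ) := fun m c hc =>
    le_card_fiber_iterSum A (f.comp φ) (fun b hb => (hst b (hAB ▸ hb)).trans (hsA b)) m
      (hAB ▸ hc)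
  have hNq := mul_le_mul_of_nonneg_right hN (Nat.cast_nonneg (α := ℤ) q)
  by_cases hcc : c = c₁
  · have h1 := hfib _ c hcB
    have h2 := sum_erase_add _ D hcB
    have h3 := card_nsmul_le_sum ((iterSum B (n + 2)).erase c) D q fun x hx =>
      hDq x (mem_of_mem_erase hx) (hcc ▸ ne_of_mem_erase hx)
    have hpos := card_pos.2 ⟨c, hcB⟩
    rw [card_erase_of_mem hcB, nsmul_eq_mul, Nat.cast_sub (by omega)] at h3
    simp only [AddMonoidHom.comp_apply] at h1
    rw [← hDc] at h1
    subst ht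
    push_cast at h1 h3
    linarith
  · obtain ⟨x, hx, b, hb, hbne, rfl⟩ := exists_summand_ne hcB (hc₁ ▸ hcc)
    have h1 := hfib _ x hx
    have h1' := card_fiber_iterSum_succ A (f.comp φ) (n + 1) (hAB ▸ hx) (hAB ▸ hb)
    have h1'' := hsA b
    have hc₁B : c₁ ∈ iterSum B (n + 2) := hc₁ ▸ nsmul_mem_iterSum hb₀ _
    have hc₁e := mem_erase.2 ⟨Ne.symm hcc, hc₁B⟩
    have h2 := sum_erase_add _ D hcB
    have h2' := sum_erase_add _ D hc₁e
    have h3 := card_nsmul_le_sum (((iterSum B (n + 2)).erase (x + b)).erase c₁) D q fun x hx =>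
      hDq x (mem_of_mem_erase (mem_of_mem_erase hx)) (ne_of_mem_erase hx)
    have hpos := card_pos.2 ⟨c₁, hc₁e⟩
    rw [card_erase_of_mem hcB] at hpos
    rw [card_erase_of_mem hc₁e, card_erase_of_mem hcB, nsmul_eq_mul, Nat.sub_sub,
      Nat.cast_sub (by omega)] at h3
    have h4 : s b₀ ≤ D c₁ := by
      refine le_trans ?_ (hDge c₁)
      obtain ⟨g, hg, hgb⟩ := mem_image.1 (hB ▸ hb₀)
      rw [Nat.cast_le, ← card_image_of_injective {x ∈ S | f x = b₀}
        (add_right_injective ((n + 1) • g))]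
      refine card_le_card fun z hz => ?_
      obtain ⟨y, hy, rfl⟩ := mem_image.1 hz
      rw [mem_filter] at hy ⊢
      refine ⟨add_mem_iterSum (nsmul_mem_iterSum hg _) hy.1, ?_⟩
      rw [map_add, map_nsmul, hgb, hy.2, hc₁, ← succ_nsmul]
    have h5 := hspair b hb b₀ hb₀ hbne
    have h6 : (n + 1 : ℤ) * (t - 1) + s b ≤ D (x + b) := by
      rw [hDc]
      simp only [AddMonoidHom.comp_apply] at h1 h1' h1''
      push_cast at h1
      zify at h1'
      change _ ≤ (#{y ∈ iterSum A (n + 1 + 1) | f (φ y) = x + b} : ℤ)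
      linarith
    subst ht
    push_cast at h3
    linarith

/-- The isoperimetric inequality descends to a quotient. -/
theorem isoperimetric_quotient {f : G →+ Q} (hf : Function.Surjective f) {q : ℕ} (hq0 : 0 < q)
    (hq : ∀ c, #{y : G | f y = c} = q) {S : Finset G} {d : ℤ}
    (hG : ∀ X : Finset G, X.Nonempty → X + S = univ ∨ (#X : ℤ) + d * q ≤ #(X + S))
    (X : Finset Q) (hX : X.Nonempty) :
    X + S.image f = univ ∨ (#X : ℤ) + d ≤ #(X + S.image f) := by
  obtain ⟨x, hx⟩ := hX
  obtain ⟨g, rfl⟩ := hf x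
  rcases hG {g : G | f g ∈ X} ⟨g, by simpa using hx⟩ with h | h
  · left
    rw [preimage_add_eq] at h
    refine eq_univ_of_forall fun c => ?_
    obtain ⟨y, rfl⟩ := hf c
    have hy := mem_univ y
    rw [← h, mem_filter] at hy
    exact hy.2
  · right
    rw [preimage_add_eq, card_preimage_of_card_fiber hq, card_preimage_of_card_fiber hq] at h
    push_cast at h
    refine le_of_mul_le_mul_right ?_ (Nat.cast_pos (α := ℤ).2 hq0)
    linarith

/-- Growth of sumsets of integers in terms of the residues in a finite group. -/
theorem iterSum_growth (A : Finset ℤ) (φ : ℤ →+ G) {l : ℤ}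
    (hl : 0 < l) (hφ : φ l = 0) (h0 : 0 ∈ A) (hlA : l ∈ A)
    (hgen : AddSubgroup.closure (A.image φ : Set G) = ⊤) (n : ℕ) :
    (#(iterSum A (n + 1)) : ℤ) +
        min (Fintype.card G : ℤ) ((n + 2) * (#(A.image φ) - 1) + 1) ≤
      #(iterSum A (n + 2)) := by
  classical
  obtain ⟨S, hS⟩ : ∃ S, S = A.image φ := ⟨_, rfl⟩
  have hS0 : 0 ∈ S := hS ▸ mem_image.2 ⟨0, h0, map_zero φ⟩
  rw [← hS] at hgen ⊢
  by_cases hSu : S = univ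
  · have h1 := card_coset_add_le A φ (0 : G →+ G) hl hφ h0 hlA (n + 1) 0
    have h2 : #S ≤ #(iterSum S (n + 2)) := card_le_card fun s hs => by
      simpa using add_mem_iterSum (nsmul_mem_iterSum hS0 (n + 1)) hs
    have h3 : #(iterSum A (n + 1)) + #(iterSum S (n + 2)) ≤ #(iterSum A (n + 2)) := by
      simpa [hS] using h1
    rw [hSu, card_univ, ← hSu] at h2
    have := min_le_left (Fintype.card G : ℤ) ((n + 2) * (#S - 1) + 1)
    omega
  obtain ⟨H, F, hFH, hFS, hiso⟩ := exists_isoperimetric_subgroup S hSu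
  let f : G →+ G ⧸ H := QuotientAddGroup.mk' H
  have hf : Function.Surjective f := QuotientAddGroup.mk'_surjective H
  have hmem : ∀ g, g ∈ F ↔ f g = 0 := fun g => by
    rw [← mem_coe, hFH, SetLike.mem_coe]; exact (QuotientAddGroup.eq_zero_iff g).symm
  have hq : ∀ c, #{y : G | f y = c} = #F := fun c => by
    obtain ⟨g, rfl⟩ := hf c
    rw [← card_vadd_finset g F]
    congr 1
    ext y
    rw [mem_filter, mem_vadd_finset]
    constructor
    · rintro ⟨-, h⟩
      exact ⟨y - g, by rw [hmem, map_sub, h, sub_self], add_sub_cancel g y⟩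
    · rintro ⟨z, hz, rfl⟩
      rw [hmem] at hz
      exact ⟨mem_univ _, by rw [vadd_eq_add, map_add, hz, add_zero]⟩
  have hq0 : 0 < #F := card_pos.2 ⟨0, by rw [hmem, map_zero]⟩
  have hFSc : #(F + S) = #(S.image f) * #F := by
    rw [← card_preimage_of_card_fiber hq, ← zero_add (S.image f), ← singleton_zero,
      ← preimage_add_eq]
    congr 2
    ext g
    simp [hmem]
  have hG : ∀ X : Finset G, X.Nonempty →
      X + S = univ ∨ (#X : ℤ) + (#(S.image f) - 1) * #F ≤ #(X + S) := fun X hX => by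
    refine (hiso X hX).imp_right fun h => ?_
    rw [hFSc] at h
    zify at h
    linarith
  refine iterSum_growth_of_isoperimetric A φ f hl hφ h0 hlA hq hS rfl ?_ hG
    (isoperimetric_quotient hf hq0 hq hG) n
  by_contra! hlt
  refine hFS (eq_univ_of_forall fun g => ?_)
  have hSH : (S : Set G) ⊆ H := fun s hs => by
    rw [← hFH, mem_coe, hmem]
    exact card_le_one.1 (Nat.le_of_lt_succ hlt) _ (mem_image_of_mem f hs) _
      (mem_image.2 ⟨0, hS0, map_zero f⟩)
  have hg : g ∈ H := (AddSubgroup.closure_le H).2 hSH (hgen ▸ AddSubgroup.mem_top g)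
  rw [← SetLike.mem_coe, ← hFH, mem_coe] at hg
  simpa using add_mem_add hg hS0

end Growth

open Finset in
/-- **Lev's theorem** on the growth of iterated sumsets of a finite set of integers. -/
theorem iterSum_growth_int (A : Finset ℤ) {l : ℤ} (hl : 0 < l) (h0 : 0 ∈ A) (hlA : l ∈ A)
    (hA : ∀ x ∈ A, 0 ≤ x ∧ x ≤ l) (hgcd : ∀ d : ℤ, (∀ x ∈ A, d ∣ x) → d ∣ 1) (n : ℕ) :
    (#(iterSum A (n + 1)) : ℤ) + min l ((n + 2) * (#A - 2) + 1) ≤ #(iterSum A (n + 2)) := by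
  lift l to ℕ using hl.le
  have : NeZero l := ⟨by omega⟩
  let φ : ℤ →+ ZMod l := (Int.castRingHom (ZMod l)).toAddMonoidHom
  have hφ : ∀ x : ℤ, φ x = (x : ZMod l) := fun _ => rfl
  have hgen : AddSubgroup.closure (A.image φ : Set (ZMod l)) = ⊤ := by
    obtain ⟨d, hd⟩ := Int.subgroup_cyclic
      ((AddSubgroup.closure (A.image φ : Set (ZMod l))).comap φ)
    have hmem : ∀ x : ℤ, φ x ∈ AddSubgroup.closure (A.image φ : Set (ZMod l)) ↔ d ∣ x := fun x => by
      rw [← AddSubgroup.mem_comap, hd, ← AddSubgroup.zmultiples_eq_closure,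
        Int.mem_zmultiples_iff]
    have hd1 := hgcd d fun x hx => (hmem x).1
      (AddSubgroup.subset_closure (mem_coe.2 (mem_image_of_mem φ hx)))
    refine (AddSubgroup.eq_top_iff' _).2 fun z => ?_
    obtain ⟨x, rfl⟩ := ZMod.intCast_surjective z
    exact (hmem x).2 (hd1.trans (one_dvd x))
  have hcard : #A ≤ #(A.image φ) + 1 := by
    have hinj : Set.InjOn φ (A.erase l : Finset ℤ) := by
      intro x hx y hy hxy
      rw [mem_coe, mem_erase] at hx hy
      have := hA x hx.2
      have := hA y hy.2
      rw [hφ, hφ, ZMod.intCast_eq_intCast_iff] at hxy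
      have h1 := Int.emod_eq_of_lt (show 0 ≤ x by omega) (show x < l by omega)
      have h2 := Int.emod_eq_of_lt (show 0 ≤ y by omega) (show y < l by omega)
      rw [← h1, ← h2]
      exact hxy
    have h1 := card_image_of_injOn hinj
    have h2 := card_le_card (image_subset_image (f := φ) (erase_subset (l : ℤ) A))
    rw [card_erase_of_mem hlA] at h1
    omega
  have h := iterSum_growth A φ hl (by rw [hφ]; simp) h0 hlA hgen n
  rw [ZMod.card] at h
  refine le_trans (add_le_add_right (min_le_min le_rfl ?_) _) h
  have : (#A : ℤ) - 2 ≤ #(A.image φ) - 1 := by omega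
  have := mul_le_mul_of_nonneg_left this (show (0 : ℤ) ≤ n + 2 by positivity)
  linarith

section SubsequenceSums

open Finset

theorem mem_SeqSub {M : Multiset ℤ} {x : ℤ} : x ∈ SeqSub M ↔ ∃ B ≤ M, B ≠ 0 ∧ B.sum = x := by
  simp [SeqSub, and_assoc]

variable {k : ℕ} {a : ℕ → ℤ} {r : ℕ → ℕ}

theorem sum_mul_mem_SeqSub (hk : 0 < k) (h0 : a 0 = 0) (hr0 : 1 ≤ r 0) {c : ℕ → ℕ}
    (hc : ∀ i, 1 ≤ i → i < k → c i ≤ r i) :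
    ∑ i ∈ range k, (c i : ℤ) * a i ∈
      SeqSub (∑ i ∈ range k, Multiset.replicate (r i) (a i)) := by
  rw [mem_SeqSub]
  refine ⟨∑ i ∈ range k, Multiset.replicate (Function.update c 0 1 i) (a i),
    sum_le_sum fun i hi => ?_, fun h => ?_, ?_⟩
  · refine Multiset.replicate_mono _ ?_
    rcases Nat.eq_zero_or_pos i with rfl | hi0
    · simpa using hr0
    · rw [Function.update_of_ne hi0.ne']
      exact hc i hi0 (mem_range.1 hi)
  · rw [Finset.sum_eq_zero_iff] at h
    simpa using h 0 (mem_range.2 hk)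
  · rw [Multiset.sum_sum]
    refine sum_congr rfl fun i _ => ?_
    rw [Multiset.sum_replicate, nsmul_eq_mul]
    rcases Nat.eq_zero_or_pos i with rfl | hi0
    · simp [h0]
    · rw [Function.update_of_ne hi0.ne']

theorem exists_multiplicities_of_mem_iterSum {n : ℕ} {x : ℤ}
    (hx : x ∈ iterSum ((range k).image a) n) :
    ∃ c : ℕ → ℕ, (∀ i, c i ≤ n) ∧ ∑ i ∈ range k, (c i : ℤ) * a i = x := by
  induction n generalizing x with
  | zero =>
    simp only [iterSum, mem_singleton] at hx
    exact ⟨0, by simp, by simp [hx]⟩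
  | succ n ih =>
    obtain ⟨y, hy, s, hs, rfl⟩ := mem_iterSum_succ.1 hx
    obtain ⟨j, hj, rfl⟩ := mem_image.1 hs
    obtain ⟨c, hc, rfl⟩ := ih hy
    refine ⟨fun i => c i + if i = j then 1 else 0, fun i => ?_, ?_⟩
    · have := hc i
      dsimp only
      split_ifs <;> omega
    · have : a j = ∑ i ∈ range k, if i = j then a i else 0 := by
        rw [sum_ite_eq' _ j a, if_pos hj]
      rw [this, ← sum_add_distrib]
      refine sum_congr rfl fun i _ => ?_
      by_cases h : i = j <;> simp [h, add_mul]

theorem le_of_mem_iterSum {A : Finset ℤ} {l : ℤ} (hA : ∀ x ∈ A, x ≤ l) {n : ℕ} {x : ℤ}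
    (hx : x ∈ iterSum A n) : x ≤ n * l := by
  induction n generalizing x with
  | zero => simp only [iterSum, mem_singleton] at hx; simp [hx]
  | succ n ih =>
    obtain ⟨y, hy, s, hs, rfl⟩ := mem_iterSum_succ.1 hx
    have := ih hy
    have := hA s hs
    push_cast
    linarith

/-- A multiplicity vector that is not maximal can be moved up by one unit of index weight, with
larger value. -/
theorem exists_multiplicities_succ (h0 : a 0 = 0) (ha : ∀ i, 1 ≤ i → i < k → a (i - 1) < a i)
    (hr : ∀ i, 1 ≤ i → i < k → 1 ≤ r i) {c : ℕ → ℕ} (hc : ∀ i, 1 ≤ i → i < k → c i ≤ r i)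
    (hlt : ∑ i ∈ range k, (i : ℤ) * c i < ∑ i ∈ range k, (i : ℤ) * r i) :
    ∃ c' : ℕ → ℕ, (∀ i, 1 ≤ i → i < k → c' i ≤ r i) ∧
      ∑ i ∈ range k, (i : ℤ) * c' i = ∑ i ∈ range k, (i : ℤ) * c i + 1 ∧
      ∑ i ∈ range k, (c i : ℤ) * a i < ∑ i ∈ range k, (c' i : ℤ) * a i := by
  have hex : ∃ i, 1 ≤ i ∧ i < k ∧ c i < r i := by
    by_contra! h
    refine hlt.not_ge (sum_le_sum fun i hi => ?_)
    rcases Nat.eq_zero_or_pos i with rfl | hi0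
    · simp
    · exact mul_le_mul_of_nonneg_left (Nat.cast_le.2 (h i hi0 (mem_range.1 hi))) (by positivity)
  classical
  obtain ⟨hj1, hjk, hjr⟩ := Nat.find_spec hex
  have hmin : ∀ i, i < Nat.find hex → ¬(1 ≤ i ∧ i < k ∧ c i < r i) := fun i => Nat.find_min hex
  generalize Nat.find hex = j at hj1 hjk hjr hmin
  have hprev : 2 ≤ j → 1 ≤ c (j - 1) := fun h2 => by
    have h1 := hmin (j - 1) (by omega)
    have h2 := hr (j - 1) (by omega) (by omega)
    by_contra h
    exact h1 ⟨by omega, by omega, by omega⟩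
  let c' : ℕ → ℕ := fun i => if i = j then c i + 1 else if i = j - 1 then c i - 1 else c i
  have key : ∀ w : ℕ → ℤ, w 0 = 0 →
      ∑ i ∈ range k, (c' i : ℤ) * w i = ∑ i ∈ range k, (c i : ℤ) * w i + (w j - w (j - 1)) := by
    intro w hw
    have e1 : w j = ∑ i ∈ range k, if i = j then w i else 0 := by
      rw [sum_ite_eq' _ j w, if_pos (mem_range.2 hjk)]
    have e2 : w (j - 1) = ∑ i ∈ range k, if i = j - 1 then w i else 0 := by
      rw [sum_ite_eq' _ (j - 1) w, if_pos (mem_range.2 (by omega))]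
    rw [e1, e2, ← sum_sub_distrib, ← sum_add_distrib]
    refine sum_congr rfl fun i _ => ?_
    simp only [c']
    by_cases hij : i = j
    · have : i ≠ j - 1 := by omega
      simp only [if_pos hij, if_neg this]
      push_cast
      ring
    · by_cases hij' : i = j - 1
      · simp only [if_neg hij, if_pos hij']
        by_cases h2 : 2 ≤ j
        · have := hprev h2
          rw [← hij'] at this
          push_cast [this]
          ring
        · have : i = 0 := by omega
          simp [this, hw]
      · simp only [if_neg hij, if_neg hij']
        ring
  refine ⟨c', fun i h1 h2 => ?_, ?_, ?_⟩
  · have := hc i h1 h2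
    simp only [c']
    split_ifs with h h'
    · subst h; omega
    · omega
    · exact this
  · have := key (fun i => i) (by simp)
    simp only [mul_comm] at this ⊢
    rw [this]
    push_cast [hj1]
    ring
  · rw [key a h0]
    linarith [ha j hj1 hjk]

/-- The number of subsequence sums exceeding a given one is at least the missing index weight. -/
theorem le_card_SeqSub_filter_lt (h0 : a 0 = 0) (ha : ∀ i, 1 ≤ i → i < k → a (i - 1) < a i)
    (hr : ∀ i, i < k → 1 ≤ r i) (d : ℕ) {c : ℕ → ℕ}
    (hc : ∀ i, 1 ≤ i → i < k → c i ≤ r i)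
    (hd : ∑ i ∈ range k, (i : ℤ) * c i + d = ∑ i ∈ range k, (i : ℤ) * r i) :
    d ≤ #{x ∈ SeqSub (∑ i ∈ range k, Multiset.replicate (r i) (a i)) |
      ∑ i ∈ range k, (c i : ℤ) * a i < x} := by
  rcases Nat.eq_zero_or_pos k with rfl | hk
  · simp only [range_zero, sum_empty] at hd
    omega
  induction d generalizing c with
  | zero => exact Nat.zero_le _
  | succ d ih =>
    push_cast at hd
    obtain ⟨c', hc', hw, hv⟩ := exists_multiplicities_succ h0 ha (fun i _ => hr i) hc (by omega)
    have h := ih hc' (by omega)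
    refine (Nat.succ_le_succ h).trans ?_
    rw [Nat.succ_eq_add_one,
      ← card_insert_of_notMem (a := ∑ i ∈ range k, (c' i : ℤ) * a i) (by simp)]
    refine card_le_card (insert_subset ?_ fun x hx => ?_)
    · exact mem_filter.2 ⟨sum_mul_mem_SeqSub hk h0 (hr 0 hk) hc', hv⟩
    · rw [mem_filter] at hx ⊢
      exact ⟨hx.1, hv.trans hx.2⟩

end SubsequenceSums

theorem freiman_subsequence_sum_zero_min_two (k : ℕ) (hk : 2 ≤ k) (a : ℕ → ℤ) (r : ℕ → ℕ)
    (h0 : a 0 = 0)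
    (ha : ∀ i j, i < j → j ≤ k - 1 → a i < a j)
    (hr : ∀ i, i ≤ k - 1 → 1 ≤ r i)
    (hgcd : (Finset.Icc 1 (k - 1)).gcd a = 1)
    (rr : ℕ) (hrr : rr = (Finset.Icc 1 (k - 1)).inf' (Finset.nonempty_Icc.mpr (by omega)) r)
    (hrr2 : 2 ≤ rr) :
    ((hfold (rr - 1) ((Finset.range k).image a)).card : ℤ)
      + min (a (k - 1)) ((rr : ℤ) * ((k : ℤ) - 2) + 1)
      + ∑ i ∈ Finset.range (k - 1), (i : ℤ) * (r i : ℤ)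
      + ((k : ℤ) - 1) * ((r (k - 1) : ℤ) - (rr : ℤ))
      ≤ ((SeqSub (∑ i ∈ Finset.range k, Multiset.replicate (r i) (a i))).card : ℤ) := by
  open Finset in
  obtain ⟨n, rfl⟩ : ∃ n, rr = n + 2 := ⟨rr - 2, by omega⟩
  obtain ⟨m, rfl⟩ : ∃ m, k = m + 2 := ⟨k - 2, by omega⟩
  simp only [show m + 2 - 1 = m + 1 from rfl, show n + 2 - 1 = n + 1 from rfl] at *
  have hrge : ∀ i, 1 ≤ i → i < m + 2 → n + 2 ≤ r i := fun i h1 h2 => by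
    rw [hrr]
    exact Finset.inf'_le _ (Finset.mem_Icc.2 ⟨h1, by omega⟩)
  have hmono : ∀ i j, i ≤ j → j < m + 2 → a i ≤ a j := fun i j hij hj => by
    rcases hij.eq_or_lt with rfl | h
    · exact le_rfl
    · exact (ha i j h (by omega)).le
  have hlpos : 0 < a (m + 1) := by
    have := ha 0 (m + 1) (by omega) le_rfl
    rwa [h0] at this
  obtain ⟨A, hA⟩ : ∃ A, A = (range (m + 2)).image a := ⟨_, rfl⟩
  have hAmem : ∀ i, i < m + 2 → a i ∈ A := fun i hi =>
    hA ▸ mem_image_of_mem a (mem_range.2 hi)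
  have hAbd : ∀ x ∈ A, 0 ≤ x ∧ x ≤ a (m + 1) := fun x hx => by
    rw [hA] at hx
    obtain ⟨i, hi, rfl⟩ := mem_image.1 hx
    rw [mem_range] at hi
    exact ⟨h0 ▸ hmono 0 i (Nat.zero_le i) hi, hmono i (m + 1) (by omega) (by omega)⟩
  have hAcard : #A = m + 2 := by
    rw [hA, card_image_of_injOn, card_range]
    intro i hi j hj hij
    rw [mem_coe, mem_range] at hi hj
    rcases lt_trichotomy i j with h | h | h
    · exact absurd hij (ha i j h (by omega)).ne
    · exact h
    · exact absurd hij (ha j i h (by omega)).ne'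
  have hlev := iterSum_growth_int A hlpos (h0 ▸ hAmem 0 (by omega)) (hAmem (m + 1) (by omega))
    hAbd (fun d hd => hgcd ▸ dvd_gcd fun i hi =>
      hd _ (hAmem i (by have := (mem_Icc.1 hi).2; omega))) n
  rw [hAcard] at hlev
  rw [hfold_eq_iterSum, ← hA]
  obtain ⟨T, hT⟩ : ∃ T, T = SeqSub (∑ i ∈ range (m + 2), Multiset.replicate (r i) (a i)) :=
    ⟨_, rfl⟩
  rw [← hT]
  let c : ℕ → ℕ := Pi.single (m + 1) (n + 2)
  have hcsum : ∀ w : ℕ → ℤ, ∑ i ∈ range (m + 2), (c i : ℤ) * w i = (n + 2) * w (m + 1) := by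
    intro w
    rw [sum_eq_single (m + 1)]
    · simp [c]
    · intro i _ hi
      simp [c, Pi.single_eq_of_ne hi]
    · simp
  have hc : ∀ i, 1 ≤ i → i < m + 2 → c i ≤ r i := fun i h1 h2 => by
    rcases eq_or_ne i (m + 1) with rfl | h
    · simpa [c] using hrge _ h1 h2
    · simp [c, Pi.single_eq_of_ne h]
  have hupper : iterSum A (n + 2) ⊆ {x ∈ T | ¬ (n + 2) * a (m + 1) < x} := fun x hx => by
    rw [mem_filter, hT, not_lt]
    constructor
    · rw [hA] at hx
      obtain ⟨e, he, rfl⟩ := exists_multiplicities_of_mem_iterSum hx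
      exact sum_mul_mem_SeqSub (by omega) h0 (hr 0 (by omega))
        fun i h1 h2 => (he i).trans (hrge i h1 h2)
    · exact_mod_cast le_of_mem_iterSum (fun x hx => (hAbd x hx).2) hx
  have hw : ∑ i ∈ range (m + 2), (i : ℤ) * c i = (n + 2) * (m + 1) := by
    have := hcsum fun i => i
    push_cast at this
    simpa only [mul_comm] using this
  have hsucc := sum_range_succ (fun i => (i : ℤ) * (r i : ℤ)) (m + 1)
  have hnonneg : 0 ≤ ∑ i ∈ range (m + 1), (i : ℤ) * (r i : ℤ) :=
    sum_nonneg fun i _ => by positivity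
  have hlast : (0 : ℤ) ≤ (m + 1) * (r (m + 1) - (n + 2)) :=
    mul_nonneg (by positivity) (by have := hrge (m + 1) (by omega) (by omega); omega)
  obtain ⟨d, hd⟩ := Int.eq_ofNat_of_zero_le (add_nonneg hnonneg hlast)
  have hchain := le_card_SeqSub_filter_lt h0 (fun i h1 h2 => ha (i - 1) i (by omega) (by omega))
    (fun i hi => hr i (by omega)) d hc (by rw [hw, hsucc, ← hd]; push_cast; ring)
  rw [hcsum, ← hT] at hchain
  have hsplit := card_filter_add_card_filter_not (s := T) fun x => (n + 2) * a (m + 1) < x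
  have hup := card_le_card hupper
  push_cast at hlev hd ⊢
  zify at hup hchain hsplit
  ring_nf at *
  linarith
end

section
/- Let k ≥ 3 and 𝔸 a finite multiset of positive integers with distinct values a_1 < ... < a_k, multiplicities r_1, ..., r_k with r_i ≥ 1 for i ≤ k-2, r_{k-1} = 1, r_k ≥ 2, gcd(a_1, ..., a_k) = 1. Let α be a positive integer with Σ_{i=1}^{k-2} r_i ≤ α < Σ_{i=1}^{k} r_i - 2. Then |S_α(𝔸)| ≥ a_k - k + 2 + (k-1)(Σ_{i=1}^{k} r_i - α) if a_k ≤ 2k - 3, and |S_α(𝔸)| ≥ θ(k+1) - k - 2 + (k-1)(Σ_{i=1}^{k} r_i - α) if a_k ≥ 2k - 2, where θ = (1+√5)/2. -/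
open Pointwise

/-- If almost all sums of two distinct elements of `X` land in a small set `Y`, and `X` generates
the group, then every nonzero element has many representations as a difference. -/
theorem card_mul_le_sq_of_distinct_sums {G : Type*} [AddCommGroup G] [Fintype G] [DecidableEq G]
    (X Y : Finset G) (h0 : (0 : G) ∈ X)
    (hgen : ∀ H : AddSubgroup G, (∀ x ∈ X, x ∈ H) → H = ⊤)
    (hXY : ∀ x ∈ X, ∀ y ∈ X, x ≠ y → x + y ∈ Y)
    (s : ℕ) (hs : Y.card + s = 2 * X.card - 2) (hs2 : X.card < 2 * s) :
    X.card + (Fintype.card G - 1) * s ≤ X.card ^ 2 := by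
  set rep : G → Finset G := fun g => X.filter (fun y => y + g ∈ X) with hrep
  have hmany : ∀ x ∈ X, ∀ y ∈ X, x ≠ y → s ≤ (rep (x - y)).card := by
    intro x hx y hy hxy
    set U := (X.erase x).image (fun u => x + u) with hU
    set V := (X.erase y).image (fun u => y + u) with hV
    have hUc : U.card = X.card - 1 := by
      rw [hU, Finset.card_image_of_injective _ (add_right_injective x), Finset.card_erase_of_mem hx]
    have hVc : V.card = X.card - 1 := by
      rw [hV, Finset.card_image_of_injective _ (add_right_injective y), Finset.card_erase_of_mem hy]
    have hUV : U ∪ V ⊆ Y := by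
      intro z hz
      simp only [hU, hV, Finset.mem_union, Finset.mem_image, Finset.mem_erase] at hz
      rcases hz with ⟨u, ⟨hu, huX⟩, rfl⟩ | ⟨u, ⟨hu, huX⟩, rfl⟩
      · exact hXY _ hx _ huX (Ne.symm hu)
      · exact hXY _ hy _ huX (Ne.symm hu)
    have hsub : (U ∩ V).image (fun z => z - x) ⊆ rep (x - y) := by
      intro z hz
      simp only [hU, hV, Finset.mem_inter, Finset.mem_image, Finset.mem_erase] at hz
      obtain ⟨w, ⟨⟨u, ⟨-, hu⟩, rfl⟩, ⟨v, ⟨-, hv⟩, huv⟩⟩, rfl⟩ := hz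
      simp only [hrep, Finset.mem_filter, add_sub_cancel_left]
      refine ⟨hu, ?_⟩
      have : u + (x - y) = v := by
        rw [← add_right_inj y, huv]; abel
      rwa [this]
    have h1 := Finset.card_le_card hsub
    rw [Finset.card_image_of_injective _ (sub_left_injective)] at h1
    have h2 := Finset.card_le_card hUV
    have h3 := Finset.card_union_add_card_inter U V
    omega
  have hrep0 : rep 0 = X := by simp [hrep]
  have hYX : s ≤ X.card := by
    have h1 : X.erase 0 ⊆ Y := fun x hx => by
      rw [Finset.mem_erase] at hx
      simpa using hXY 0 h0 x hx.2 (Ne.symm hx.1)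
    have h2 := Finset.card_le_card h1
    rw [Finset.card_erase_of_mem h0] at h2
    omega
  have hbig : ∀ g, (rep g).Nonempty → s ≤ (rep g).card := by
    rintro g ⟨y, hy⟩
    rw [Finset.mem_filter] at hy
    by_cases hg : g = 0
    · rw [hg, hrep0]
      exact hYX
    · have := hmany _ hy.2 _ hy.1 (by simpa using hg)
      simpa using this
  have hsub : ∀ c d, (rep c).Nonempty → (rep d).Nonempty → (rep (c - d)).Nonempty := by
    intro c d hc hd
    have h1 := hbig c hc
    have h2 := hbig d hd
    have h3 := Finset.card_union_add_card_inter (rep c) (rep d)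
    have h4 : (rep c ∪ rep d).card ≤ X.card :=
      Finset.card_le_card (Finset.union_subset (Finset.filter_subset _ _)
        (Finset.filter_subset _ _))
    have h5 : 0 < (rep c ∩ rep d).card := by omega
    obtain ⟨y, hy⟩ := Finset.card_pos.1 h5
    simp only [hrep, Finset.mem_inter, Finset.mem_filter] at hy
    refine ⟨y + d, ?_⟩
    simp only [hrep, Finset.mem_filter]
    refine ⟨hy.2.2, ?_⟩
    have : y + d + (c - d) = y + c := by abel
    rw [this]
    exact hy.1.2
  have hz : (rep 0).Nonempty := ⟨0, by rw [hrep0]; exact h0⟩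
  have hall : ∀ g, (rep g).Nonempty := by
    have hneg : ∀ c, (rep c).Nonempty → (rep (-c)).Nonempty := fun c hc => by
      simpa using hsub 0 c hz hc
    let H : AddSubgroup G :=
      { carrier := {g | (rep g).Nonempty}
        zero_mem' := hz
        add_mem' := fun {c d} hc hd => by
          have := hsub c (-d) hc (hneg d hd)
          rwa [sub_neg_eq_add] at this
        neg_mem' := fun {c} hc => hneg c hc }
    have hH : H = ⊤ := hgen H (fun x hx => ⟨0, by simp [hrep, h0, hx]⟩)
    intro g
    have : g ∈ H := by rw [hH]; trivial
    exact this
  have hsum : ∑ g : G, (rep g).card = X.card ^ 2 := by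
    have h1 : ∀ g, (rep g).card = ∑ y ∈ X, if y + g ∈ X then 1 else 0 := by
      intro g
      simp only [hrep, Finset.card_filter]
    simp_rw [h1]
    rw [Finset.sum_comm]
    have h2 : ∀ y ∈ X, (∑ g : G, if y + g ∈ X then 1 else 0) = X.card := by
      intro y _
      exact (Equiv.sum_comp (Equiv.addLeft y) (fun z => if z ∈ X then 1 else 0)).trans (by simp)
    rw [Finset.sum_congr rfl h2]
    simp [sq]
  rw [← hsum, ← Finset.add_sum_erase _ _ (Finset.mem_univ (0 : G)), hrep0]
  have h6 : (Finset.univ.erase (0 : G)).card • s ≤ ∑ g ∈ Finset.univ.erase (0 : G), (rep g).card :=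
    Finset.card_nsmul_le_sum _ _ _ (fun g _ => hbig g (hall g))
  rw [Finset.card_erase_of_mem (Finset.mem_univ _), Finset.card_univ, smul_eq_mul] at h6
  omega

/-- A subset of `ZMod N` of more than `N / 2 + 1` elements represents every residue as a sum of
two distinct elements. -/
theorem ZMod.exists_add_eq_of_card {N : ℕ} [NeZero N] (X : Finset (ZMod N))
    (hX : N + 3 ≤ 2 * X.card) (c : ZMod N) : ∃ x ∈ X, ∃ y ∈ X, x ≠ y ∧ x + y = c := by
  set W := X ∩ X.image (fun x => c - x) with hW
  have hWc : 3 ≤ W.card := by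
    have h1 := Finset.card_union_add_card_inter X (X.image (fun x => c - x))
    rw [Finset.card_image_of_injective _ (sub_right_injective), ← hW] at h1
    have h2 := Finset.card_le_univ (X ∪ X.image (fun x => c - x))
    rw [ZMod.card] at h2
    omega
  have hdbl : (W.filter (fun x => x + x = c)).card ≤ 2 := by
    rcases (W.filter (fun x => x + x = c)).eq_empty_or_nonempty with h | ⟨w, hw⟩
    · simp [h]
    · have h2 := IsAddCyclic.card_nsmul_eq_zero_le (α := ZMod N) (n := 2) (by norm_num)
      refine le_trans ?_ h2
      refine Finset.card_le_card_of_injOn (fun x => x - w) ?_ (sub_left_injective.injOn)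
      intro x hx
      simp only [Finset.coe_filter, Set.mem_ofPred_eq, Finset.mem_filter] at hx hw ⊢
      refine ⟨Finset.mem_univ _, ?_⟩
      rw [two_nsmul]
      have : x - w + (x - w) = (x + x) - (w + w) := by abel
      rw [this, hx.2, hw.2, sub_self]
  have h3 := Finset.card_filter_add_card_filter_not (s := W) (fun x => x + x = c)
  have h4 : 0 < (W.filter (fun x => ¬ x + x = c)).card := by omega
  obtain ⟨x, hx⟩ := Finset.card_pos.1 h4
  simp only [hW, Finset.mem_filter, Finset.mem_inter, Finset.mem_image] at hx
  obtain ⟨⟨hxX, y, hy, rfl⟩, hne⟩ := hx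
  refine ⟨c - y, hxX, y, hy, ?_, by abel⟩
  intro h
  apply hne
  nth_rewrite 1 [h]
  abel

/-- A subgroup of `ZMod N` containing integers without common factor is everything. -/
theorem ZMod.addSubgroup_eq_top_of_gcd {ι : Type*} {N : ℕ} (s : Finset ι) (a : ι → ℤ)
    (hgcd : s.gcd a = 1) (H : AddSubgroup (ZMod N)) (hH : ∀ i ∈ s, ((a i : ℤ) : ZMod N) ∈ H) :
    H = ⊤ := by
  obtain ⟨d, hd⟩ := Int.subgroup_cyclic (H.comap (Int.castAddHom (ZMod N)))
  rw [← AddSubgroup.zmultiples_eq_closure] at hd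
  have hdvd : d ∣ s.gcd a := Finset.dvd_gcd fun i hi => by
    have : a i ∈ H.comap (Int.castAddHom (ZMod N)) := hH i hi
    rwa [hd, Int.mem_zmultiples_iff] at this
  rw [hgcd] at hdvd
  rw [eq_top_iff]
  intro x _
  obtain ⟨z, rfl⟩ := ZMod.intCast_surjective x
  have : z ∈ H.comap (Int.castAddHom (ZMod N)) := by
    rw [hd, Int.mem_zmultiples_iff]
    exact hdvd.trans (one_dvd z)
  exact this

/-- Counting the sums of sub-multisets residue class by residue class modulo `N`. -/
theorem card_seqSubAlpha_ge {N : ℕ} [NeZero N] (A A' : Multiset ℤ) (X Y : Finset (ZMod N))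
    (hXY : X ⊆ Y) (α m : ℕ) (hm : 1 ≤ m) (hα : α + m = Multiset.card A)
    (hA : A' + Multiset.replicate (m - 1) (N : ℤ) ≤ A)
    (hX : ∀ c ∈ X, ∃ B ≤ A', Multiset.card B ≤ 1 ∧ ((B.sum : ℤ) : ZMod N) = c)
    (hY : ∀ c ∈ Y, ∃ B ≤ A', Multiset.card B ≤ 2 ∧ ((B.sum : ℤ) : ZMod N) = c) :
    X.card * m + (Y.card - X.card) * (m - 1) ≤ (SeqSubAlpha α A).card := by
  have hB : ∀ c : ZMod N, ∃ B : Multiset ℤ, c ∈ Y → (B ≤ A' ∧ Multiset.card B ≤ 2 ∧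
      (c ∈ X → Multiset.card B ≤ 1) ∧ ((B.sum : ℤ) : ZMod N) = c) := by
    intro c
    by_cases hc : c ∈ X
    · obtain ⟨B, h1, h2, h3⟩ := hX c hc
      exact ⟨B, fun _ => ⟨h1, by omega, fun _ => h2, h3⟩⟩
    · by_cases hc' : c ∈ Y
      · obtain ⟨B, h1, h2, h3⟩ := hY c hc'
        exact ⟨B, fun _ => ⟨h1, h2, fun h => absurd h hc, h3⟩⟩
      · exact ⟨0, fun h => absurd h hc'⟩
  choose B hB using hB
  set P := X ×ˢ Finset.range m ∪ (Y \ X) ×ˢ Finset.range (m - 1) with hP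
  have hPc : P.card = X.card * m + (Y.card - X.card) * (m - 1) := by
    rw [hP, Finset.card_union_of_disjoint, Finset.card_product, Finset.card_product,
      Finset.card_range, Finset.card_range, Finset.card_sdiff_of_subset hXY]
    exact Finset.disjoint_product.2 (Or.inl Finset.disjoint_sdiff)
  have hPY : ∀ p ∈ P, p.1 ∈ Y ∧ p.2 ≤ m - 1 ∧ Multiset.card (B p.1) + p.2 ≤ m := by
    rintro ⟨c, j⟩ hp
    simp only [hP, Finset.mem_union, Finset.mem_product, Finset.mem_range,
      Finset.mem_sdiff] at hp ⊢
    rcases hp with ⟨hc, hj⟩ | ⟨⟨hc, -⟩, hj⟩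
    · have := (hB c (hXY hc)).2.2.1 hc
      exact ⟨hXY hc, by omega, by omega⟩
    · have := (hB c hc).2.1
      exact ⟨hc, by omega, by omega⟩
  rw [← hPc]
  refine Finset.card_le_card_of_injOn (fun p : ZMod N × ℕ => A.sum - ((B p.1).sum + p.2 * (N : ℤ))) ?_ ?_
  · intro p hp
    obtain ⟨hc, hj, hcard⟩ := hPY p hp
    have hle : B p.1 + Multiset.replicate p.2 (N : ℤ) ≤ A :=
      (add_le_add (hB _ hc).1 (Multiset.replicate_le_replicate _ |>.2 hj)).trans hA
    simp only [SeqSubAlpha, Finset.mem_coe, Multiset.mem_toFinset, Multiset.mem_map,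
      Multiset.mem_filter, Multiset.mem_powerset]
    refine ⟨A - (B p.1 + Multiset.replicate p.2 (N : ℤ)), ⟨Multiset.sub_le_self _ _, ?_⟩, ?_⟩
    · rw [Multiset.card_sub hle, Multiset.card_add, Multiset.card_replicate]
      omega
    · have h := congrArg Multiset.sum (tsub_add_cancel_of_le hle)
      simp only [Multiset.sum_add, Multiset.sum_replicate, nsmul_eq_mul] at h
      linarith
  · rintro ⟨c, j⟩ hp ⟨c', j'⟩ hp' h
    have h1 : (B c).sum + j * (N : ℤ) = (B c').sum + j' * (N : ℤ) := by
      simpa using h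
    have hcc : c = c' := by
      have h2 := congrArg (fun z : ℤ => (z : ZMod N)) h1
      simpa [(hB c (hPY _ hp).1).2.2.2, (hB c' (hPY _ hp').1).2.2.2] using h2
    subst hcc
    have hN : (N : ℤ) ≠ 0 := by exact_mod_cast NeZero.ne N
    have h3 : (j : ℤ) = j' := mul_right_cancel₀ hN (add_left_cancel h1)
    rw [Nat.cast_inj.1 h3]

theorem theta_le : theta ≤ 13 / 8 := by
  have h : Real.sqrt 5 ≤ 9 / 4 := Real.sqrt_le_iff.2 ⟨by norm_num, by norm_num⟩
  rw [theta]
  linarith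

theorem freiman_alpha_subsequence_sum_special (k : ℕ) (hk : 3 ≤ k) (a : ℕ → ℤ) (r : ℕ → ℕ)
    (ha : ∀ i j, 1 ≤ i → i < j → j ≤ k → a i < a j)
    (hpos : ∀ i, 1 ≤ i → i ≤ k → 0 < a i)
    (hr : ∀ i, 1 ≤ i → i ≤ k - 2 → 1 ≤ r i)
    (hrk1 : r (k - 1) = 1) (hrk : 2 ≤ r k)
    (hgcd : (Finset.Icc 1 k).gcd a = 1)
    (α : ℕ) (hα1 : 1 ≤ α)
    (hα2 : (∑ i ∈ Finset.Icc 1 (k - 2), r i) ≤ α)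
    (hα3 : α < (∑ i ∈ Finset.Icc 1 k, r i) - 2) :
    (a k ≤ 2 * (k : ℤ) - 3 →
      a k - (k : ℤ) + 2 + ((k : ℤ) - 1) * ((∑ i ∈ Finset.Icc 1 k, (r i : ℤ)) - (α : ℤ))
        ≤ ((SeqSubAlpha α (∑ i ∈ Finset.Icc 1 k, Multiset.replicate (r i) (a i))).card : ℤ)) ∧
    (2 * (k : ℤ) - 2 ≤ a k →
      theta * ((k : ℝ) + 1) - (k : ℝ) - 2
          + ((k : ℝ) - 1) * ((∑ i ∈ Finset.Icc 1 k, (r i : ℝ)) - (α : ℝ))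
        ≤ ((SeqSubAlpha α (∑ i ∈ Finset.Icc 1 k, Multiset.replicate (r i) (a i))).card : ℝ)) := by
  have hka : 0 < a k := hpos k (by omega) le_rfl
  obtain ⟨N, hN⟩ := Int.eq_ofNat_of_zero_le hka.le
  have hN0 : 0 < N := by omega
  have : NeZero N := ⟨hN0.ne'⟩
  set I := Finset.Icc 1 (k - 1) with hI
  have hIcc : Finset.Icc 1 k = insert k I := by
    ext i
    simp only [hI, Finset.mem_Icc, Finset.mem_insert]
    omega
  have hkI : k ∉ I := by
    simp only [hI, Finset.mem_Icc]
    omega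
  have hI2 : I = insert (k - 1) (Finset.Icc 1 (k - 2)) := by
    ext i
    simp only [hI, Finset.mem_Icc, Finset.mem_insert]
    omega
  have hkI2 : k - 1 ∉ Finset.Icc 1 (k - 2) := by
    simp only [Finset.mem_Icc]
    omega
  have hrI : ∀ i ∈ I, 1 ≤ r i := by
    intro i hi
    rw [hI2, Finset.mem_insert] at hi
    rcases hi with rfl | hi
    · exact hrk1.ge
    · rw [Finset.mem_Icc] at hi
      exact hr i hi.1 hi.2
  have hR : ∑ i ∈ Finset.Icc 1 k, r i = r k + (1 + ∑ i ∈ Finset.Icc 1 (k - 2), r i) := by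
    rw [hIcc, Finset.sum_insert hkI, hI2, Finset.sum_insert hkI2, hrk1]
  obtain ⟨m, hm⟩ : ∃ m, α + m = ∑ i ∈ Finset.Icc 1 k, r i :=
    ⟨_, Nat.add_sub_cancel' (by omega)⟩
  have hm3 : 3 ≤ m := by omega
  set A : Multiset ℤ := ∑ i ∈ Finset.Icc 1 k, Multiset.replicate (r i) (a i) with hA
  have hAcard : α + m = Multiset.card A := by
    rw [hm, hA, Multiset.card_sum]
    simp
  have hbase : I.val.map a + Multiset.replicate (m - 1) (N : ℤ) ≤ A := by
    rw [hA, hIcc, Finset.sum_insert hkI, add_comm, hN]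
    refine add_le_add ((Multiset.replicate_le_replicate _).2 (by omega)) ?_
    have h1 : I.val.map a = ∑ i ∈ I, {a i} := by
      rw [← Multiset.sum_map_singleton (I.val.map a), Multiset.map_map]
      rfl
    rw [h1]
    refine Finset.sum_le_sum fun i hi => ?_
    rw [← Multiset.replicate_one]
    exact (Multiset.replicate_le_replicate _).2 (hrI i hi)
  -- residues of sums of at most `n` of the first `k - 1` values
  set Z : ℕ → Finset (ZMod N) := fun n =>
    (I.powerset.filter (fun s => s.card ≤ n)).image (fun s => ((∑ i ∈ s, a i : ℤ) : ZMod N))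
    with hZ
  have hmem : ∀ n, ∀ s ⊆ I, s.card ≤ n → ((∑ i ∈ s, a i : ℤ) : ZMod N) ∈ Z n := by
    intro n s hs hsn
    exact Finset.mem_image.2 ⟨s, Finset.mem_filter.2 ⟨Finset.mem_powerset.2 hs, hsn⟩, rfl⟩
  have hrepr : ∀ n, ∀ c ∈ Z n, ∃ B ≤ I.val.map a, Multiset.card B ≤ n ∧
      ((B.sum : ℤ) : ZMod N) = c := by
    intro n c hc
    obtain ⟨s, hs, rfl⟩ := Finset.mem_image.1 hc
    rw [Finset.mem_filter, Finset.mem_powerset] at hs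
    exact ⟨s.val.map a, Multiset.map_le_map (Finset.val_le_iff.2 hs.1), by simpa using hs.2, rfl⟩
  have hXY : Z 1 ⊆ Z 2 := Finset.image_subset_image
    (Finset.monotone_filter_right _ fun s _ hs => hs.trans one_le_two)
  have h0X : (0 : ZMod N) ∈ Z 1 := by simpa using hmem 1 ∅ (Finset.empty_subset _) (by simp)
  have haX : ∀ i ∈ I, ((a i : ℤ) : ZMod N) ∈ Z 1 := fun i hi => by
    simpa using hmem 1 {i} (Finset.singleton_subset_iff.2 hi) (by simp)
  have hXcases : ∀ x ∈ Z 1, x = 0 ∨ ∃ i ∈ I, x = ((a i : ℤ) : ZMod N) := by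
    intro x hx
    obtain ⟨s, hs, rfl⟩ := Finset.mem_image.1 hx
    rw [Finset.mem_filter, Finset.mem_powerset, Finset.card_le_one_iff_subset_singleton] at hs
    obtain ⟨hsI, i, hi⟩ := hs
    rcases Finset.subset_singleton_iff.1 hi with rfl | rfl
    · simp
    · right
      exact ⟨i, hsI (Finset.mem_singleton_self i), by simp⟩
  have hadd : ∀ x ∈ Z 1, ∀ y ∈ Z 1, x ≠ y → x + y ∈ Z 2 := by
    intro x hx y hy hxy
    rcases hXcases x hx with rfl | ⟨i, hi, rfl⟩
    · rw [zero_add]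
      exact hXY hy
    rcases hXcases y hy with rfl | ⟨j, hj, rfl⟩
    · rw [add_zero]
      exact hXY hx
    have hij : i ≠ j := fun h => hxy (by rw [h])
    have := hmem 2 {i, j} (by
      intro l hl
      rw [Finset.mem_insert, Finset.mem_singleton] at hl
      rcases hl with rfl | rfl <;> assumption) Finset.card_le_two
    rwa [Finset.sum_pair hij, Int.cast_add] at this
  have hXcard : (Z 1).card = k := by
    have haIk : ∀ i ∈ I, 0 < a i ∧ a i < N := by
      intro i hi
      rw [hI, Finset.mem_Icc] at hi
      exact ⟨hpos i hi.1 (by omega), by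
        have := ha i k hi.1 (by omega) le_rfl
        omega⟩
    have hinj : Set.InjOn a I := by
      intro i hi j hj hij
      rw [hI, Finset.mem_coe, Finset.mem_Icc] at hi hj
      rcases lt_trichotomy i j with h | h | h
      · exact absurd hij (ha i j hi.1 h (by omega)).ne
      · exact h
      · exact absurd hij (ha j i hj.1 h (by omega)).ne'
    have himg : Z 1 = (insert 0 (I.image a)).image (fun z : ℤ => (z : ZMod N)) := by
      ext x
      simp only [Finset.mem_image, Finset.mem_insert]
      constructor
      · intro hx
        rcases hXcases x hx with rfl | ⟨i, hi, rfl⟩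
        · exact ⟨0, Or.inl rfl, by simp⟩
        · exact ⟨a i, Or.inr ⟨i, hi, rfl⟩, rfl⟩
      · rintro ⟨z, rfl | ⟨i, hi, rfl⟩, rfl⟩
        · simpa using h0X
        · exact haX i hi
    have h0 : (0 : ℤ) ∉ I.image a := by
      intro h
      obtain ⟨i, hi, h⟩ := Finset.mem_image.1 h
      have := haIk i hi
      omega
    have hrange : ∀ z ∈ insert 0 (I.image a), 0 ≤ z ∧ z < (N : ℤ) := by
      intro z hz
      rw [Finset.mem_insert, Finset.mem_image] at hz
      rcases hz with rfl | ⟨i, hi, rfl⟩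
      · omega
      · exact ⟨(haIk i hi).1.le, (haIk i hi).2⟩
    rw [himg, Finset.card_image_of_injOn, Finset.card_insert_of_notMem h0,
      Finset.card_image_of_injOn hinj, hI, Nat.card_Icc]
    · omega
    · intro z hz w hw hzw
      have h1 := hrange z hz
      have h2 := hrange w hw
      have h3 := (ZMod.intCast_eq_intCast_iff' z w N).1 hzw
      rwa [Int.emod_eq_of_lt h1.1 h1.2, Int.emod_eq_of_lt h2.1 h2.2] at h3
  have hcount := card_seqSubAlpha_ge A (I.val.map a) (Z 1) (Z 2) hXY α m (by omega) hAcard hbase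
    (hrepr 1) (hrepr 2)
  obtain ⟨t, ht⟩ := Nat.exists_eq_add_of_le (Finset.card_le_card hXY)
  rw [ht, Nat.add_sub_cancel_left, hXcard] at hcount
  rw [hXcard] at ht
  obtain ⟨n, rfl⟩ : ∃ n, m = n + 3 := ⟨m - 3, by omega⟩
  have hcount' : k * (n + 3) + t * (n + 2) ≤ (SeqSubAlpha α A).card := hcount
  have hkN : k ≤ N := by
    have := Finset.card_le_univ (Z 1)
    rwa [ZMod.card, hXcard] at this
  constructor
  · intro hle
    have htN : k + t = N := by
      have : Z 2 = Finset.univ := by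
        rw [Finset.eq_univ_iff_forall]
        intro c
        obtain ⟨x, hx, y, hy, hne, rfl⟩ := ZMod.exists_add_eq_of_card (Z 1) (by omega) c
        exact hadd x hx y hy hne
      rw [← ht, this, Finset.card_univ, ZMod.card]
    have hmZ : (∑ i ∈ Finset.Icc 1 k, (r i : ℤ)) - (α : ℤ) = n + 3 := by
      rw [sub_eq_iff_eq_add']
      exact_mod_cast hm.symm
    rw [hmZ, hN, ← htN]
    have : (k : ℤ) * (n + 3) + t * (n + 2) ≤ ((SeqSubAlpha α A).card : ℤ) := by
      exact_mod_cast hcount'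
    refine le_trans ?_ this
    push_cast
    nlinarith [mul_nonneg (Int.natCast_nonneg t) (Int.natCast_nonneg n)]
  · intro hge
    have hbound : 5 * k ≤ 16 * t + 27 := by
      by_contra! hlt
      have hkey := card_mul_le_sq_of_distinct_sums (Z 1) (Z 2) h0X
        (fun H hH => ZMod.addSubgroup_eq_top_of_gcd _ a hgcd H fun i hi => by
          rw [hIcc, Finset.mem_insert] at hi
          rcases hi with rfl | hi
          · simp [hN]
          · exact hH _ (haX i hi)) hadd (k - t - 2) (by omega) (by omega)
      rw [hXcard, ZMod.card] at hkey
      obtain ⟨s, hs⟩ : ∃ s, k = s + t + 2 := ⟨k - t - 2, by omega⟩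
      have hs' : k - t - 2 = s := by omega
      rw [hs'] at hkey
      have h1 : (2 * k - 3) * s ≤ (N - 1) * s := Nat.mul_le_mul_right _ (by omega)
      obtain ⟨l, hl⟩ : ∃ l, k = l + 3 := ⟨k - 3, by omega⟩
      have h2 : k + 1 ≤ 2 * s := by omega
      have h3 : 2 * k - 3 = 2 * l + 3 := by omega
      rw [h3] at h1
      have h4 : (2 * l + 3) * (l + 4) ≤ (2 * l + 3) * (2 * s) := Nat.mul_le_mul_left _ (by omega)
      rw [hl] at hkey
      nlinarith
    have hmR : (∑ i ∈ Finset.Icc 1 k, (r i : ℝ)) - (α : ℝ) = n + 3 := by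
      rw [sub_eq_iff_eq_add']
      exact_mod_cast hm.symm
    rw [hmR]
    have h1 : (k : ℝ) * (n + 3) + t * (n + 2) ≤ ((SeqSubAlpha α A).card : ℝ) := by
      exact_mod_cast hcount'
    have h2 : (5 : ℝ) * k ≤ 16 * t + 27 := by exact_mod_cast hbound
    refine le_trans ?_ h1
    have h3 : theta * ((k : ℝ) + 1) ≤ 13 / 8 * (k + 1) :=
      mul_le_mul_of_nonneg_right theta_le (by positivity)
    have h4 : (0 : ℝ) ≤ t * n := by positivity
    nlinarith [(Nat.cast_nonneg n : (0 : ℝ) ≤ n)]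
end
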